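/- Orthogonality relation for the bivariate quantum q-Krawtchouk polynomials: for every real q with 0 < q < 1, every positive integer N, all nonzero real numbers θ, φ, and all integers n₁, n₂, m₁, m₂ ≥ 0 with n₁+n₂ ≤ N and m₁+m₂ ≤ N, one has Σ_{x₁,x₂ ≥ 0, x₁+x₂ ≤ N} Δ^{(N)}_{x₁,x₂}(θ,φ) · K_{n₁,n₂}(x₁,x₂;θ,φ;N) · K_{m₁,m₂}(x₁,x₂;θ,φ;N) = H^{(N)}_{n₁,n₂}(θ,φ) · δ_{n₁ m₁} δ_{n₂ m₂}. -/

import Mathlib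

open Finset

/-- The q-Pochhammer symbol `(a;q)_n = ∏_{k=0}^{n-1} (1 - a q^k)`. -/
noncomputable def qPoch (q a : ℝ) (n : ℕ) : ℝ := ∏ k ∈ Finset.range n, (1 - a * q ^ k)

/-- The quantum q-Krawtchouk polynomial `k_n(x;p,N;q)`, defined for all integers `x, N`. -/
noncomputable def qKraw (q : ℝ) (n : ℕ) (x N : ℤ) (p : ℝ) : ℝ :=
  (-1 : ℝ) ^ n * q ^ (n * (n - 1) / 2) *
    ∑ k ∈ Finset.range (n + 1),
      qPoch q (q ^ (-(n : ℤ))) k * qPoch q (q ^ (-x)) k *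
        qPoch q (q ^ ((k : ℤ) - N)) (n - k) / qPoch q q k * (p * q ^ (n + 1)) ^ k

/-- The bivariate quantum q-Krawtchouk polynomial of Gasper and Rahman,
`K_{n₁,n₂}(x₁,x₂;θ,φ;N) = k_{n₁}(x₁;θ^{-2},x₁+x₂;q) k_{n₂}(x₁+x₂-n₁;φ^{-2},N-n₁;q)`,
with the convention that it vanishes when a degree index is negative. -/
noncomputable def Kq (q : ℝ) (n₁ n₂ x₁ x₂ : ℤ) (θ φ : ℝ) (N : ℤ) : ℝ :=
  if 0 ≤ n₁ ∧ 0 ≤ n₂ then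
    qKraw q n₁.toNat x₁ (x₁ + x₂) (θ ^ 2)⁻¹ *
      qKraw q n₂.toNat (x₁ + x₂ - n₁) (N - n₁) (φ ^ 2)⁻¹
  else 0

/-- The q-trinomial coefficient `[N; x₁, x₂]_q`. -/
noncomputable def qTrinom (q : ℝ) (N x₁ x₂ : ℕ) : ℝ :=
  qPoch q q N / (qPoch q q x₁ * qPoch q q x₂ * qPoch q q (N - x₁ - x₂))

/-- The orthogonality weight `Δ^{(N)}_{x₁,x₂}(θ,φ)`. -/
noncomputable def Δw (q : ℝ) (N x₁ x₂ : ℕ) (θ φ : ℝ) : ℝ :=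
  (-1 : ℝ) ^ (N - x₁) * (θ ^ 2 * q⁻¹) ^ (x₁ + x₂) * q ^ (x₁ * (x₁ - 1) / 2) *
    qTrinom q N x₁ x₂ * qPoch q ((θ ^ 2)⁻¹ * q) x₂ * qPoch q ((φ ^ 2)⁻¹ * q) (N - x₁ - x₂) *
    φ ^ (2 * N) * q ^ (-((N : ℤ) * (N + 1) / 2))

/-- The normalization constant `H^{(N)}_{n₁,n₂}(θ,φ)`. -/
noncomputable def Hn (q : ℝ) (N n₁ n₂ : ℕ) (θ φ : ℝ) : ℝ :=
  (-1 : ℝ) ^ (n₁ + n₂) * qPoch q (q * (θ ^ 2)⁻¹) n₁ * qPoch q (q * (φ ^ 2)⁻¹) n₂ *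
    φ ^ (2 * n₁) * (qPoch q q N / qPoch q q (N - n₁ - n₂)) ^ 2 * (qTrinom q N n₁ n₂)⁻¹ *
    q ^ (3 * ((n₁ : ℤ) * (n₁ - 1)) / 2 + 3 * ((n₂ : ℤ) * (n₂ - 1)) / 2 +
          (n₁ : ℤ) * n₂ - (N : ℤ) * (n₁ + n₂) - 2 * n₁ - n₂)

/-- The dual weight `Δ̃^{(N)}_{n₁,n₂}(θ,φ)`. -/
noncomputable def Δdual (q : ℝ) (N n₁ n₂ : ℕ) (θ φ : ℝ) : ℝ :=
  (-1 : ℝ) ^ (n₁ + n₂) * q ^ (-((n₁ : ℤ) * (n₁ - 1)) - (n₂ : ℤ) * (n₂ - 1)) *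
    φ ^ (-(2 * (n₁ : ℤ))) * (qPoch q q (N - n₁ - n₂) / qPoch q q N) ^ 2 * qTrinom q N n₁ n₂ *
    q ^ ((N : ℤ) * (n₁ + n₂) + 2 * n₁ + n₂ - (n₁ : ℤ) * n₂ -
          (n₁ : ℤ) * (n₁ - 1) / 2 - (n₂ : ℤ) * (n₂ - 1) / 2) /
    (qPoch q (q * (θ ^ 2)⁻¹) n₁ * qPoch q (q * (φ ^ 2)⁻¹) n₂)

lemma qPoch_succ (q a : ℝ) (n : ℕ) : qPoch q a (n + 1) = qPoch q a n * (1 - a * q ^ n) :=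
  Finset.prod_range_succ _ _

lemma qPoch_succ' (q a : ℝ) (n : ℕ) : qPoch q a (n + 1) = (1 - a) * qPoch q (a * q) n := by
  simp only [qPoch, Finset.prod_range_succ', pow_zero, mul_one, pow_succ']
  rw [mul_comm]
  simp only [mul_assoc]

@[simp] lemma qPoch_zero (q a : ℝ) : qPoch q a 0 = 1 := Finset.prod_range_zero _

lemma qPoch_self_ne_zero {q : ℝ} (hq0 : 0 < q) (hq1 : q < 1) (n : ℕ) : qPoch q q n ≠ 0 := by
  refine Finset.prod_ne_zero_iff.mpr fun k _ => ?_
  rw [← pow_succ']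
  exact (sub_pos.mpr (pow_lt_one₀ hq0.le hq1 k.succ_ne_zero)).ne'

lemma qPoch_inv_pow_succ {q : ℝ} (hq : q ≠ 0) (m : ℕ) : qPoch q (q ^ m)⁻¹ (m + 1) = 0 := by
  rw [qPoch_succ, inv_mul_cancel₀ (pow_ne_zero m hq), sub_self, mul_zero]

lemma inv_pow_succ_mul_self {q : ℝ} (hq : q ≠ 0) (n : ℕ) : (q ^ (n + 1))⁻¹ * q = (q ^ n)⁻¹ := by
  rw [pow_succ, mul_inv, inv_mul_cancel_right₀ hq]

lemma succ_choose_two (n : ℕ) : (n + 1).choose 2 = n + n.choose 2 := by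
  rw [Nat.choose_succ_succ' n 1, Nat.choose_one_right]

/-- The quantum q-Krawtchouk polynomial as a function of `y = q^{-x}` and `Q = q^{-N}`. -/
noncomputable def qKrawPoly (q : ℝ) (n : ℕ) (y Q p : ℝ) : ℝ :=
  (-1 : ℝ) ^ n * q ^ n.choose 2 *
    ∑ k ∈ Finset.range (n + 1),
      qPoch q (q ^ n)⁻¹ k * qPoch q y k * qPoch q (Q * q ^ k) (n - k) / qPoch q q k *
        (p * q ^ (n + 1)) ^ k

lemma qKraw_eq_qKrawPoly {q : ℝ} (hq : q ≠ 0) (n : ℕ) (x N : ℤ) (p : ℝ) :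
    qKraw q n x N p = qKrawPoly q n (q ^ (-x)) (q ^ (-N)) p := by
  have h (k : ℕ) : q ^ ((k : ℤ) - N) = q ^ (-N) * q ^ k := by
    rw [sub_eq_add_neg, zpow_add₀ hq, zpow_natCast, mul_comm]
  simp only [qKraw, qKrawPoly, h, zpow_neg q (n : ℤ), zpow_natCast, Nat.choose_two_right]

lemma qKrawPoly_zero (q y Q p : ℝ) : qKrawPoly q 0 y Q p = 1 := by
  simp [qKrawPoly]

lemma qKrawPoly_succ_one_one (q p : ℝ) (n : ℕ) : qKrawPoly q (n + 1) 1 1 p = 0 := by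
  have h (k : ℕ) : qPoch q 1 (k + 1) = 0 := by simp [qPoch_succ']
  rw [qKrawPoly, Finset.sum_range_succ']
  simp [h]

lemma qPoch_sub_shift {q : ℝ} (hq : q ≠ 0) (y : ℝ) (k : ℕ) :
    qPoch q (y * q⁻¹) (k + 1) - qPoch q y (k + 1) =
      -(y * q⁻¹) * (1 - q ^ (k + 1)) * qPoch q y k := by
  rw [qPoch_succ', qPoch_succ, inv_mul_cancel_right₀ hq]
  field_simp
  ring

/-- The forward shift relation. -/
lemma qKrawPoly_lowering {q : ℝ} (hq0 : 0 < q) (hq1 : q < 1) (m : ℕ) (y Q p : ℝ) :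
    qKrawPoly q (m + 1) (y * q⁻¹) Q p - qKrawPoly q (m + 1) y Q p =
      -(y * p * q ^ m * (1 - q ^ (m + 1))) * qKrawPoly q m y (Q * q) (p * q) := by
  have hq := hq0.ne'
  simp only [qKrawPoly]
  rw [← mul_sub, ← Finset.sum_sub_distrib, Finset.sum_range_succ']
  simp only [qPoch_zero, sub_self, add_zero]
  rw [← mul_assoc, Finset.mul_sum, Finset.mul_sum]
  refine Finset.sum_congr rfl fun k _ => ?_
  have h1 := qPoch_sub_shift hq y k
  have h2 : qPoch q (q ^ (m + 1))⁻¹ (k + 1) = (1 - (q ^ (m + 1))⁻¹) * qPoch q (q ^ m)⁻¹ k := by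
    rw [qPoch_succ', inv_pow_succ_mul_self hq]
  have h3 : Q * q ^ (k + 1) = Q * q * q ^ k := by ring
  have h4 := qPoch_self_ne_zero hq0 hq1 (k + 1)
  have h5 := qPoch_self_ne_zero hq0 hq1 k
  rw [← sub_mul, ← sub_div, ← sub_mul, ← mul_sub, h1, h2, h3, Nat.add_sub_add_right,
    succ_choose_two]
  have h7 := qPoch_succ q q k
  rw [← pow_succ'] at h7
  rw [h7] at h4 ⊢
  have h8 := right_ne_zero_of_mul h4
  field_simp
  ring

lemma qKrawPoly_raising_coeff {q : ℝ} (hq0 : 0 < q) (hq1 : q < 1) {m k : ℕ} (hk : k ≤ m) (Q : ℝ)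
    (hQ : Q ≠ 0) :
    -(qPoch q (q ^ (m + 1))⁻¹ (k + 1) * qPoch q (Q * q ^ (k + 1)) (m + 1 - (k + 1)) /
        qPoch q q (k + 1)) * (Q * q ^ (k + 1))⁻¹ =
      qPoch q (q ^ m)⁻¹ (k + 1) * qPoch q (Q * q * q ^ (k + 1)) (m - (k + 1)) /
        qPoch q q (k + 1) * (1 - (Q * q ^ (k + 1))⁻¹) +
      qPoch q (q ^ m)⁻¹ k * qPoch q (Q * q * q ^ k) (m - k) / qPoch q q k *
        (Q * q ^ (m + k + 2))⁻¹ := by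
  have hq := hq0.ne'
  have h2 : qPoch q (q ^ (m + 1))⁻¹ (k + 1) = (1 - (q ^ (m + 1))⁻¹) * qPoch q (q ^ m)⁻¹ k := by
    rw [qPoch_succ', inv_pow_succ_mul_self hq]
  have h3 : Q * q * q ^ k = Q * q ^ (k + 1) := by ring
  have h4 := qPoch_self_ne_zero hq0 hq1 (k + 1)
  have h5 := qPoch_self_ne_zero hq0 hq1 k
  have h7 := qPoch_succ q q k
  rw [← pow_succ'] at h7
  rw [h2, h3, Nat.add_sub_add_right, qPoch_succ q (q ^ m)⁻¹ k]
  rw [h7] at h4 ⊢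
  have h8 := right_ne_zero_of_mul h4
  obtain rfl | ⟨d, rfl⟩ : k = m ∨ ∃ d, m = k + 1 + d := by
    rcases hk.eq_or_lt with h | h
    · exact Or.inl h
    · exact Or.inr ⟨m - (k + 1), by omega⟩
  · simp only [Nat.sub_self, qPoch_zero]
    field_simp
    ring
  · have h9 : k + 1 + d - k = d + 1 := by omega
    have h10 : k + 1 + d - (k + 1) = d := by omega
    have h11 : Q * q * q ^ (k + 1) = Q * q ^ (k + 1) * q := by ring
    rw [h9, h10, qPoch_succ', h11]
    field_simp
    ring

/-- The backward shift relation. -/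
lemma qKrawPoly_raising {q : ℝ} (hq0 : 0 < q) (hq1 : q < 1) (m : ℕ) (y Q p : ℝ) (hQ : Q ≠ 0) :
    (y - 1) * (1 - p * q * y * Q⁻¹) * qKrawPoly q m (y * q) (Q * q) (p * q) +
        (1 - y * Q⁻¹) * qKrawPoly q m y (Q * q) (p * q) =
      y * (Q * q ^ m)⁻¹ * qKrawPoly q (m + 1) y Q p := by
  have hq := hq0.ne'
  set A := p * q ^ (m + 2) with hA
  have hA' : p * q * q ^ (m + 1) = A := by rw [hA]; ring
  let D : ℕ → ℝ := fun k => qPoch q y k - qPoch q y (k + 1)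
  have hD (k : ℕ) : y * qPoch q y k = (q ^ k)⁻¹ * D k := by
    simp only [D, qPoch_succ]
    field_simp
    ring
  let a : ℕ → ℝ := fun k =>
    qPoch q (q ^ m)⁻¹ k * qPoch q (Q * q * q ^ k) (m - k) / qPoch q q k
  let b : ℕ → ℝ := fun k =>
    qPoch q (q ^ (m + 1))⁻¹ k * qPoch q (Q * q ^ k) (m + 1 - k) / qPoch q q k
  have hL : (y - 1) * (1 - p * q * y * Q⁻¹) * qKrawPoly q m (y * q) (Q * q) (p * q) +
        (1 - y * Q⁻¹) * qKrawPoly q m y (Q * q) (p * q) =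
      (-1) ^ m * q ^ m.choose 2 * (∑ k ∈ Finset.range (m + 1),
        a k * A ^ k * (1 - (Q * q ^ k)⁻¹) * D k +
        ∑ k ∈ Finset.range (m + 1), a k * A ^ (k + 1) * (Q * q ^ (m + k + 2))⁻¹ * D (k + 1)) := by
    simp only [qKrawPoly, hA', ← Finset.sum_add_distrib, Finset.mul_sum]
    refine Finset.sum_congr rfl fun k _ => ?_
    have e1 : (1 - y) * qPoch q (y * q) k = qPoch q y (k + 1) := (qPoch_succ' q y k).symm
    have e2 := hD k
    have e3 := hD (k + 1)
    have e4 : p * q * Q⁻¹ = A * (Q * q ^ (m + 1))⁻¹ := by rw [hA]; field_simp; ring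
    have e5 : (1 - y * Q⁻¹) * qPoch q y k = qPoch q y k - (Q * q ^ k)⁻¹ * D k := by
      rw [mul_inv, mul_assoc, ← e2]; ring
    have e6 : (y - 1) * (1 - p * q * y * Q⁻¹) * qPoch q (y * q) k =
        - qPoch q y (k + 1) + A * (Q * q ^ (m + k + 2))⁻¹ * D (k + 1) := by
      have : (Q * q ^ (m + k + 2))⁻¹ * D (k + 1) =
          (Q * q ^ (m + 1))⁻¹ * (y * qPoch q y (k + 1)) := by
        rw [e3]; field_simp; ring
      rw [mul_assoc A, this, ← e1]
      linear_combination (y - 1) * (-y) * qPoch q (y * q) k * e4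
    have e7 : qPoch q y k = D k + qPoch q y (k + 1) := by simp [D]
    linear_combination (-1) ^ m * q ^ m.choose 2 * a k * A ^ k * (e5 + e6 + e7)
  have hR : y * (Q * q ^ m)⁻¹ * qKrawPoly q (m + 1) y Q p =
      (-1) ^ m * q ^ m.choose 2 *
        ∑ k ∈ Finset.range (m + 2), -b k * A ^ k * (Q * q ^ k)⁻¹ * D k := by
    simp only [qKrawPoly, Finset.mul_sum]
    refine Finset.sum_congr rfl fun k _ => ?_
    have e2 := hD k
    rw [mul_inv Q (q ^ k), mul_assoc _ (Q⁻¹ * _), mul_assoc Q⁻¹, ← e2, succ_choose_two,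
      pow_add q, mul_inv, hA]
    simp only [b]
    field_simp
    ring
  rw [hL, hR]
  congr 1
  have h0 : a (m + 1) = 0 := by simp only [a, qPoch_inv_pow_succ hq, zero_mul, zero_div]
  have hext : ∑ k ∈ Finset.range (m + 1), a k * A ^ k * (1 - (Q * q ^ k)⁻¹) * D k =
      ∑ k ∈ Finset.range (m + 2), a k * A ^ k * (1 - (Q * q ^ k)⁻¹) * D k := by
    rw [Finset.sum_range_succ _ (m + 1), h0]
    ring
  rw [hext, Finset.sum_range_succ' _ (m + 1), Finset.sum_range_succ' _ (m + 1), add_right_comm,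
    ← Finset.sum_add_distrib]
  congr 1
  · refine Finset.sum_congr rfl fun k hk => ?_
    have e := qKrawPoly_raising_coeff hq0 hq1 (Nat.lt_succ_iff.mp (Finset.mem_range.mp hk)) Q hQ
    linear_combination -A ^ (k + 1) * D (k + 1) * e
  · have : b 0 = (1 - Q) * a 0 := by
      simp [a, b, qPoch_succ']
    rw [this]
    field_simp
    ring

/-- The univariate weight at `x`, with `y = N - x`. -/
noncomputable def qKrawWeight (q p : ℝ) (x y : ℕ) : ℝ :=
  (-1 : ℝ) ^ x * q ^ x.choose 2 * (qPoch q q (x + y) / (qPoch q q x * qPoch q q y)) *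
    qPoch q (p * q) y

lemma qKrawWeight_succ_left {q : ℝ} (hq0 : 0 < q) (hq1 : q < 1) (p : ℝ) (x y : ℕ) :
    (1 - q ^ (x + 1)) * qKrawWeight q p (x + 1) y =
      -((1 - q ^ (x + y + 1)) * q ^ x * qKrawWeight q p x y) := by
  have h4 := qPoch_self_ne_zero hq0 hq1 (x + 1)
  have h5 := qPoch_self_ne_zero hq0 hq1 y
  have h7 := qPoch_succ q q x
  have h9 := qPoch_succ q q (x + y)
  rw [← pow_succ'] at h7 h9
  simp only [qKrawWeight, succ_choose_two, show x + 1 + y = x + y + 1 by ring]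
  rw [h7] at h4 ⊢
  rw [h9]
  have h8 := right_ne_zero_of_mul h4
  have h10 := left_ne_zero_of_mul h4
  field_simp
  ring

lemma qKrawWeight_succ_right {q : ℝ} (hq0 : 0 < q) (hq1 : q < 1) (p : ℝ) (x y : ℕ) :
    (1 - q ^ (y + 1)) * qKrawWeight q p x (y + 1) =
      (1 - q ^ (x + y + 1)) * (1 - p * q ^ (y + 1)) * qKrawWeight q p x y := by
  have h4 := qPoch_self_ne_zero hq0 hq1 (y + 1)
  have h5 := qPoch_self_ne_zero hq0 hq1 x
  have h7 := qPoch_succ q q y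
  have h9 := qPoch_succ q q (x + y)
  rw [← pow_succ'] at h7 h9
  simp only [qKrawWeight, ← add_assoc]
  rw [h7] at h4 ⊢
  rw [h9, qPoch_succ q (p * q)]
  have h8 := right_ne_zero_of_mul h4
  have h10 := left_ne_zero_of_mul h4
  field_simp
  ring

lemma qKrawWeight_shift (q p : ℝ) (x y : ℕ) :
    (1 - p * q ^ (y + 1)) * qKrawWeight q p x y = (1 - p * q) * qKrawWeight q (p * q) x y := by
  have h := qPoch_succ q (p * q) y
  rw [qPoch_succ', show p * q * q ^ y = p * q ^ (y + 1) by ring] at h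
  simp only [qKrawWeight]
  linear_combination -(-1 : ℝ) ^ x * q ^ x.choose 2 *
    (qPoch q q (x + y) / (qPoch q q x * qPoch q q y)) * h

lemma sum_qKrawWeight {q : ℝ} (hq0 : 0 < q) (hq1 : q < 1) (p : ℝ) (N : ℕ) :
    ∑ z ∈ antidiagonal N, qKrawWeight q p z.1 z.2 = (-p) ^ N * q ^ (N + 1).choose 2 := by
  induction N with
  | zero => simp [qKrawWeight]
  | succ N ih =>
    have hN : (1 - q ^ (N + 1)) ≠ 0 :=
      (sub_pos.mpr (pow_lt_one₀ hq0.le hq1 N.succ_ne_zero)).ne'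
    have h1 : (1 - q ^ (N + 1)) * ∑ z ∈ antidiagonal (N + 1), qKrawWeight q p z.1 z.2 =
        ∑ z ∈ antidiagonal (N + 1), (1 - q ^ z.1) * qKrawWeight q p z.1 z.2 +
        ∑ z ∈ antidiagonal (N + 1), q ^ z.1 * ((1 - q ^ z.2) * qKrawWeight q p z.1 z.2) := by
      rw [Finset.mul_sum, ← Finset.sum_add_distrib]
      refine Finset.sum_congr rfl fun z hz => ?_
      rw [← mem_antidiagonal.mp hz]
      ring
    apply mul_left_cancel₀ hN
    rw [h1, Finset.Nat.sum_antidiagonal_succ, Finset.Nat.sum_antidiagonal_succ']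
    simp only [pow_zero, sub_self, zero_mul, mul_zero, zero_add,
      qKrawWeight_succ_left hq0 hq1, qKrawWeight_succ_right hq0 hq1]
    rw [← Finset.sum_add_distrib, succ_choose_two (N + 1)]
    calc _ = ∑ z ∈ antidiagonal N, (1 - q ^ (N + 1)) * (-p * q ^ (N + 1)) *
          qKrawWeight q p z.1 z.2 := by
          refine Finset.sum_congr rfl fun z hz => ?_
          rw [← mem_antidiagonal.mp hz]
          ring
      _ = _ := by
          rw [← Finset.mul_sum, ih]
          ring

/-- The two shift operators are adjoint to each other. -/
lemma sum_qKrawWeight_mul_succ {q : ℝ} (hq0 : 0 < q) (hq1 : q < 1) (n N : ℕ) (p : ℝ)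
    (f : ℕ → ℝ) :
    ∑ z ∈ antidiagonal (N + 1), qKrawWeight q p z.1 z.2 *
        qKrawPoly q (n + 1) (q ^ z.1)⁻¹ (q ^ (N + 1))⁻¹ p * f z.1 =
      -(q ^ n * (q ^ (N + 1))⁻¹ * (1 - p * q) * (1 - q ^ (N + 1))) *
        ∑ z ∈ antidiagonal N, qKrawWeight q (p * q) z.1 z.2 *
          qKrawPoly q n (q ^ z.1)⁻¹ (q ^ N)⁻¹ (p * q) * (q ^ z.1 * (f (z.1 + 1) - f z.1)) := by
  have hq := hq0.ne'
  set c := q ^ n * (q ^ (N + 1))⁻¹ with hc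
  set Q := (q ^ (N + 1))⁻¹ with hQ
  have hQ0 : Q ≠ 0 := by positivity
  have hQq : (q ^ N)⁻¹ = Q * q := (inv_pow_succ_mul_self hq N).symm
  have h1 : ∑ z ∈ antidiagonal (N + 1), qKrawWeight q p z.1 z.2 *
        qKrawPoly q (n + 1) (q ^ z.1)⁻¹ Q p * f z.1 =
      c * (∑ z ∈ antidiagonal (N + 1), (1 - q ^ z.1) * qKrawWeight q p z.1 z.2 *
          ((1 - p * q ^ (z.2 + 1)) * qKrawPoly q n ((q ^ z.1)⁻¹ * q) (Q * q) (p * q) * f z.1) +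
        ∑ z ∈ antidiagonal (N + 1), (1 - q ^ z.2) * qKrawWeight q p z.1 z.2 *
          (q ^ z.1 * qKrawPoly q n (q ^ z.1)⁻¹ (Q * q) (p * q) * f z.1)) := by
    rw [← Finset.sum_add_distrib, Finset.mul_sum]
    refine Finset.sum_congr rfl fun z hz => ?_
    have e := qKrawPoly_raising hq0 hq1 n (q ^ z.1)⁻¹ Q p hQ0
    have hz' := mem_antidiagonal.mp hz
    have e1 : q * (q ^ z.1)⁻¹ * Q⁻¹ = q ^ (z.2 + 1) := by
      rw [hQ, ← hz']; field_simp; ring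
    have e2 : q ^ z.1 * (q ^ z.1)⁻¹ = 1 := mul_inv_cancel₀ (by positivity)
    have e3 : (q ^ z.1)⁻¹ * Q⁻¹ = q ^ z.2 := by
      rw [hQ, ← hz']; field_simp; ring
    have e4 : c * (Q * q ^ n)⁻¹ = 1 := by
      rw [hc]; field_simp
    have e5 : p * q * (q ^ z.1)⁻¹ * Q⁻¹ = p * q ^ (z.2 + 1) := by rw [← e1]; ring
    have e6 : q ^ z.1 * ((q ^ z.1)⁻¹ - 1) = 1 - q ^ z.1 := by rw [mul_sub, e2, mul_one]
    rw [e5, e3] at e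
    rw [← e6]
    linear_combination (-qKrawWeight q p z.1 z.2 * f z.1 * c * q ^ z.1) * e -
      qKrawWeight q p z.1 z.2 * f z.1 * qKrawPoly q (n + 1) (q ^ z.1)⁻¹ Q p *
        (e2 * c * (Q * q ^ n)⁻¹ + e4)
  rw [h1, Finset.Nat.sum_antidiagonal_succ, Finset.Nat.sum_antidiagonal_succ']
  simp only [pow_zero, sub_self, zero_mul, zero_add,
      qKrawWeight_succ_left hq0 hq1, qKrawWeight_succ_right hq0 hq1]
  rw [← Finset.sum_add_distrib, Finset.mul_sum, Finset.mul_sum, hQq]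
  refine Finset.sum_congr rfl fun z hz => ?_
  have e := qKrawWeight_shift q p z.1 z.2
  rw [inv_pow_succ_mul_self hq, mem_antidiagonal.mp hz]
  linear_combination c * (1 - q ^ (N + 1)) * q ^ z.1 *
    qKrawPoly q n (q ^ z.1)⁻¹ (Q * q) (p * q) * (f z.1 - f (z.1 + 1)) * e

/-- The squared norm of the univariate polynomial of degree `n`. -/
noncomputable def qKrawNorm (q p : ℝ) (n N : ℕ) : ℝ :=
  if n ≤ N then
    (-1 : ℝ) ^ (N - n) * p ^ N * qPoch q (p * q) n * qPoch q q n *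
      (qPoch q q N / qPoch q q (N - n)) * (q ^ (n * n) / q ^ (2 * n)) * q ^ (N - n + 1).choose 2
  else 0

lemma qKrawNorm_succ_succ {q : ℝ} (hq0 : 0 < q) (p : ℝ) (n N : ℕ) :
    qKrawNorm q p (n + 1) (N + 1) = q ^ n * (q ^ (N + 1))⁻¹ * (1 - p * q) * (1 - q ^ (N + 1)) *
      (p * q ^ n * (1 - q ^ (n + 1))) * qKrawNorm q (p * q) n N := by
  have hq := hq0.ne'
  simp only [qKrawNorm, Nat.add_le_add_iff_right]
  split_ifs with h
  · obtain ⟨M, rfl⟩ := Nat.exists_eq_add_of_le h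
    rw [Nat.add_sub_add_right, Nat.add_sub_cancel_left, qPoch_succ' q (p * q), qPoch_succ q q n,
      qPoch_succ q q (n + M)]
    field_simp
    ring
  · rw [mul_zero]

/-- Orthogonality of the univariate quantum q-Krawtchouk polynomials. -/
lemma sum_qKrawWeight_mul_qKrawPoly {q : ℝ} (hq0 : 0 < q) (hq1 : q < 1) (n m N : ℕ) (p : ℝ) :
    ∑ z ∈ antidiagonal N, qKrawWeight q p z.1 z.2 * qKrawPoly q n (q ^ z.1)⁻¹ (q ^ N)⁻¹ p *
      qKrawPoly q m (q ^ z.1)⁻¹ (q ^ N)⁻¹ p = if n = m then qKrawNorm q p n N else 0 := by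
  have hq := hq0.ne'
  have hsucc_zero (n N : ℕ) (p : ℝ) : ∑ z ∈ antidiagonal N, qKrawWeight q p z.1 z.2 *
      qKrawPoly q (n + 1) (q ^ z.1)⁻¹ (q ^ N)⁻¹ p = 0 := by
    cases N with
    | zero => simp [qKrawPoly_succ_one_one]
    | succ N => simpa using sum_qKrawWeight_mul_succ hq0 hq1 n N p fun _ => 1
  induction n generalizing m N p with
  | zero =>
    cases m with
    | zero =>
      simp only [qKrawPoly_zero, mul_one, sum_qKrawWeight hq0 hq1, qKrawNorm]
      have := qPoch_self_ne_zero hq0 hq1 N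
      simp [this, neg_pow p]
    | succ m => simpa [qKrawPoly_zero] using hsucc_zero m N p
  | succ n ih =>
    cases m with
    | zero => simpa [qKrawPoly_zero] using hsucc_zero n N p
    | succ m =>
      cases N with
      | zero => simp [qKrawPoly_succ_one_one, qKrawNorm]
      | succ N =>
        rw [sum_qKrawWeight_mul_succ hq0 hq1 n N p
          fun x => qKrawPoly q (m + 1) (q ^ x)⁻¹ (q ^ (N + 1))⁻¹ p]
        have key (x : ℕ) : q ^ x * (qKrawPoly q (m + 1) (q ^ (x + 1))⁻¹ (q ^ (N + 1))⁻¹ p -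
            qKrawPoly q (m + 1) (q ^ x)⁻¹ (q ^ (N + 1))⁻¹ p) =
            -(p * q ^ m * (1 - q ^ (m + 1))) * qKrawPoly q m (q ^ x)⁻¹ (q ^ N)⁻¹ (p * q) := by
          have e := qKrawPoly_lowering hq0 hq1 m (q ^ x)⁻¹ (q ^ (N + 1))⁻¹ p
          rw [← mul_inv, ← pow_succ, inv_pow_succ_mul_self hq] at e
          rw [e]
          field_simp
        simp only [key]
        have e := ih m N (p * q)
        simp only [Nat.add_right_cancel_iff]
        calc _ = q ^ n * (q ^ (N + 1))⁻¹ * (1 - p * q) * (1 - q ^ (N + 1)) *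
              (p * q ^ m * (1 - q ^ (m + 1))) * ∑ z ∈ antidiagonal N,
                qKrawWeight q (p * q) z.1 z.2 * qKrawPoly q n (q ^ z.1)⁻¹ (q ^ N)⁻¹ (p * q) *
                  qKrawPoly q m (q ^ z.1)⁻¹ (q ^ N)⁻¹ (p * q) := by
              rw [Finset.mul_sum, Finset.mul_sum]
              refine Finset.sum_congr rfl fun z _ => ?_
              ring
          _ = _ := by
              rw [e]
              split_ifs with h
              · rw [h, qKrawNorm_succ_succ hq0]
              · rw [mul_zero]

lemma Kq_natCast {q : ℝ} (hq : q ≠ 0) (n₁ n₂ x y N : ℕ) (θ φ : ℝ) :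
    Kq q n₁ n₂ x y θ φ N = qKrawPoly q n₁ (q ^ x)⁻¹ (q ^ (x + y))⁻¹ (θ ^ 2)⁻¹ *
      qKraw q n₂ (((x + y : ℕ) : ℤ) - n₁) (N - n₁) (φ ^ 2)⁻¹ := by
  have h : (x : ℤ) + y = ((x + y : ℕ) : ℤ) := by push_cast; rfl
  rw [Kq, if_pos ⟨n₁.cast_nonneg, n₂.cast_nonneg⟩, Int.toNat_natCast, Int.toNat_natCast, h,
    qKraw_eq_qKrawPoly hq n₁, zpow_neg, zpow_neg, zpow_natCast, zpow_natCast]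

/-- The factor of `Δw` that depends on `x₁, x₂` only through `s = x₁ + x₂`. -/
noncomputable def ΔwOuter (q : ℝ) (N s : ℕ) (θ φ : ℝ) : ℝ :=
  (-1 : ℝ) ^ N * (θ ^ 2 * q⁻¹) ^ s * (qPoch q q N / (qPoch q q s * qPoch q q (N - s))) *
    qPoch q ((φ ^ 2)⁻¹ * q) (N - s) * φ ^ (2 * N) * (q ^ (N + 1).choose 2)⁻¹

lemma Δw_eq_ΔwOuter_mul {q : ℝ} (hq0 : 0 < q) (hq1 : q < 1) {N x y : ℕ} (h : x + y ≤ N)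
    (θ φ : ℝ) :
    Δw q N x y θ φ = ΔwOuter q N (x + y) θ φ * qKrawWeight q (θ ^ 2)⁻¹ x y := by
  have h1 : (-1 : ℝ) ^ (N - x) = (-1) ^ N * (-1) ^ x := by
    conv_rhs => rw [← Nat.sub_add_cancel ((Nat.le_add_right x y).trans h), pow_add, mul_assoc,
      ← mul_pow]
    simp
  have h2 : q ^ (-((N : ℤ) * (N + 1) / 2)) = (q ^ (N + 1).choose 2)⁻¹ := by
    rw [zpow_neg, ← zpow_natCast, Nat.choose_two_right]
    congr 2
    push_cast
    rw [mul_comm]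
  have h3 := qPoch_self_ne_zero hq0 hq1 (x + y)
  rw [Δw, ΔwOuter, qKrawWeight, qTrinom, h1, h2, Nat.sub_sub, Nat.choose_two_right x]
  have h4 : qPoch q q N / (qPoch q q x * qPoch q q y * qPoch q q (N - (x + y))) =
      qPoch q q N / (qPoch q q (x + y) * qPoch q q (N - (x + y))) *
        (qPoch q q (x + y) / (qPoch q q x * qPoch q q y)) := by
    field_simp
  rw [h4]
  ring

lemma ΔwOuter_mul_qKrawNorm {q : ℝ} (hq0 : 0 < q) (hq1 : q < 1) (n x y : ℕ) {θ : ℝ} (hθ : θ ≠ 0)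
    (φ : ℝ) :
    ΔwOuter q (n + (x + y)) (n + x) θ φ * qKrawNorm q (θ ^ 2)⁻¹ n (n + x) =
      (-1) ^ (n + (x + y)) * (qPoch q q (n + (x + y)) / qPoch q q (x + y)) *
        φ ^ (2 * (n + (x + y))) * (q ^ (n + (x + y) + 1).choose 2)⁻¹ *
        qPoch q ((θ ^ 2)⁻¹ * q) n * qPoch q q n * (q ^ (n * n) / q ^ (3 * n)) *
        qKrawWeight q (φ ^ 2)⁻¹ x y := by
  have h1 : n + (x + y) - (n + x) = y := by omega
  have h2 := qPoch_self_ne_zero hq0 hq1 (x + y)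
  have h3 := qPoch_self_ne_zero hq0 hq1 (n + x)
  have h4 := qPoch_self_ne_zero hq0 hq1 x
  have h5 := qPoch_self_ne_zero hq0 hq1 y
  generalize hP : qPoch q ((θ ^ 2)⁻¹ * q) n = P
  simp only [ΔwOuter, qKrawNorm, qKrawWeight, hP, mul_pow, inv_pow, if_pos (Nat.le_add_right n x),
    h1, Nat.add_sub_cancel_left, succ_choose_two x]
  field_simp
  ring

lemma Hn_eq {q : ℝ} (hq0 : 0 < q) (hq1 : q < 1) (n k l : ℕ) (θ : ℝ) {φ : ℝ} (hφ : φ ≠ 0) :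
    Hn q (n + (k + l)) n k θ φ =
      (-1) ^ (n + (k + l)) * (qPoch q q (n + (k + l)) / qPoch q q (k + l)) *
        φ ^ (2 * (n + (k + l))) * (q ^ (n + (k + l) + 1).choose 2)⁻¹ *
        qPoch q ((θ ^ 2)⁻¹ * q) n * qPoch q q n * (q ^ (n * n) / q ^ (3 * n)) *
        qKrawNorm q (φ ^ 2)⁻¹ k (k + l) := by
  have hq := hq0.ne'
  have h2 := qPoch_self_ne_zero hq0 hq1 (k + l)
  have h3 := qPoch_self_ne_zero hq0 hq1 (n + (k + l))
  have h4 := qPoch_self_ne_zero hq0 hq1 n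
  have h5 := qPoch_self_ne_zero hq0 hq1 k
  have h6 := qPoch_self_ne_zero hq0 hq1 l
  have hdiv (a : ℤ) : 3 * (a * (a - 1)) / 2 * 2 = 3 * (a * (a - 1)) :=
    Int.ediv_mul_cancel ((Int.even_mul_pred_self a).two_dvd.mul_left 3)
  have hch (a : ℕ) : (((a + 1).choose 2 : ℕ) : ℤ) * 2 = (a + 1) * a := by
    rw [Nat.choose_two_right]
    exact_mod_cast Nat.div_mul_cancel (Nat.even_mul_pred_self (a + 1)).two_dvd
  have hexp : 3 * ((n : ℤ) * (n - 1)) / 2 + 3 * ((k : ℤ) * (k - 1)) / 2 + (n : ℤ) * k -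
      ((n + (k + l) : ℕ) : ℤ) * (n + k) - 2 * n - k =
      ((n * n : ℕ) : ℤ) + ((k * k : ℕ) : ℤ) + ((l + 1).choose 2 : ℕ) -
        ((n + (k + l) + 1).choose 2 : ℕ) - ((3 * n : ℕ) : ℤ) - ((2 * k : ℕ) : ℤ) := by
    have e1 := hdiv n
    have e2 := hdiv k
    have e3 := hch l
    have e4 := hch (n + (k + l))
    apply mul_right_cancel₀ (two_ne_zero (α := ℤ))
    push_cast at e4 ⊢
    linear_combination e1 + e2 - e3 + e4
  simp only [Hn, qKrawNorm, qTrinom, hexp, if_pos (Nat.le_add_right k l),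
    Nat.add_sub_cancel_left]
  rw [zpow_sub₀ hq, zpow_sub₀ hq, zpow_sub₀ hq, zpow_add₀ hq, zpow_add₀ hq]
  simp only [zpow_natCast, mul_comm q]
  have hs : (-1 : ℝ) ^ (n + (k + l)) * (-1) ^ l = (-1) ^ (n + k) := by
    rw [← add_assoc, pow_add _ (n + k), mul_assoc, ← mul_pow]
    simp
  rw [← hs, inv_pow]
  generalize qPoch q ((φ ^ 2)⁻¹ * q) k = P
  field_simp
  ring

/-- Orthogonality relation for the bivariate quantum q-Krawtchouk polynomials. -/
theorem orthogonality (q : ℝ) (hq0 : 0 < q) (hq1 : q < 1)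
    (N : ℕ) (hN : 0 < N) (θ φ : ℝ) (hθ : θ ≠ 0) (hφ : φ ≠ 0)
    (n₁ n₂ m₁ m₂ : ℕ) (hn : n₁ + n₂ ≤ N) (hm : m₁ + m₂ ≤ N) :
    ∑ x₁ ∈ Finset.range (N + 1), ∑ x₂ ∈ Finset.range (N + 1 - x₁),
      Δw q N x₁ x₂ θ φ * Kq q n₁ n₂ x₁ x₂ θ φ N * Kq q m₁ m₂ x₁ x₂ θ φ N
      = if n₁ = m₁ ∧ n₂ = m₂ then Hn q N n₁ n₂ θ φ else 0 := by
  have hq := hq0.ne'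
  let E : ℕ → ℕ → ℕ → ℝ := fun n k s => qKraw q k ((s : ℤ) - n) (N - n) (φ ^ 2)⁻¹
  have hinner : ∑ x₁ ∈ Finset.range (N + 1), ∑ x₂ ∈ Finset.range (N + 1 - x₁),
      Δw q N x₁ x₂ θ φ * Kq q n₁ n₂ x₁ x₂ θ φ N * Kq q m₁ m₂ x₁ x₂ θ φ N =
      ∑ s ∈ Finset.range (N + 1), ΔwOuter q N s θ φ * E n₁ n₂ s * E m₁ m₂ s *
        if n₁ = m₁ then qKrawNorm q (θ ^ 2)⁻¹ n₁ s else 0 := by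
    rw [← Finset.sum_range_diag_flip (N + 1) fun x₁ x₂ : ℕ =>
      Δw q N x₁ x₂ θ φ * Kq q n₁ n₂ x₁ x₂ θ φ N * Kq q m₁ m₂ x₁ x₂ θ φ N]
    refine Finset.sum_congr rfl fun s hs => ?_
    rw [← sum_qKrawWeight_mul_qKrawPoly hq0 hq1, Finset.mul_sum,
      ← Finset.Nat.sum_antidiagonal_eq_sum_range_succ fun x₁ x₂ : ℕ =>
        Δw q N x₁ x₂ θ φ * Kq q n₁ n₂ x₁ x₂ θ φ N * Kq q m₁ m₂ x₁ x₂ θ φ N]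
    refine Finset.sum_congr rfl fun z hz => ?_
    have hz := mem_antidiagonal.mp hz
    have hs := Finset.mem_range.mp hs
    rw [Δw_eq_ΔwOuter_mul hq0 hq1 (by omega), Kq_natCast hq, Kq_natCast hq, hz]
    ring
  rw [hinner]
  by_cases h : n₁ = m₁
  swap
  · simp [h]
  subst h
  obtain ⟨M, rfl⟩ := Nat.exists_eq_add_of_le ((Nat.le_add_right n₁ n₂).trans hn)
  have hE (k x : ℕ) : E n₁ k (n₁ + x) = qKrawPoly q k (q ^ x)⁻¹ (q ^ M)⁻¹ (φ ^ 2)⁻¹ := by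
    have e1 : ((n₁ + x : ℕ) : ℤ) - n₁ = x := by push_cast; ring
    have e2 : ((n₁ + M : ℕ) : ℤ) - n₁ = M := by push_cast; ring
    simp only [E]
    rw [e1, e2, qKraw_eq_qKrawPoly hq, zpow_neg, zpow_neg, zpow_natCast, zpow_natCast]
  have hlow : ∑ s ∈ Finset.range n₁, ΔwOuter q (n₁ + M) s θ φ * E n₁ n₂ s * E n₁ m₂ s *
      qKrawNorm q (θ ^ 2)⁻¹ n₁ s = 0 :=
    Finset.sum_eq_zero fun s hs => by
      rw [qKrawNorm, if_neg (not_le.mpr (Finset.mem_range.mp hs)), mul_zero]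
  simp only [if_true, true_and]
  rw [add_assoc, Finset.sum_range_add, hlow, zero_add]
  have houter := sum_qKrawWeight_mul_qKrawPoly hq0 hq1 n₂ m₂ M (φ ^ 2)⁻¹
  rw [← Finset.Nat.sum_antidiagonal_eq_sum_range_succ fun x _ : ℕ =>
    ΔwOuter q (n₁ + M) (n₁ + x) θ φ * E n₁ n₂ (n₁ + x) * E n₁ m₂ (n₁ + x) *
      qKrawNorm q (θ ^ 2)⁻¹ n₁ (n₁ + x)]
  trans (-1) ^ (n₁ + M) * (qPoch q q (n₁ + M) / qPoch q q M) *
        φ ^ (2 * (n₁ + M)) * (q ^ (n₁ + M + 1).choose 2)⁻¹ *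
        qPoch q ((θ ^ 2)⁻¹ * q) n₁ * qPoch q q n₁ * (q ^ (n₁ * n₁) / q ^ (3 * n₁)) *
        if n₂ = m₂ then qKrawNorm q (φ ^ 2)⁻¹ n₂ M else 0
  · rw [← houter, Finset.mul_sum]
    refine Finset.sum_congr rfl fun z hz => ?_
    have e := ΔwOuter_mul_qKrawNorm hq0 hq1 n₁ z.1 z.2 hθ φ
    rw [mem_antidiagonal.mp hz] at e
    rw [hE, hE]
    linear_combination qKrawPoly q n₂ (q ^ z.1)⁻¹ (q ^ M)⁻¹ (φ ^ 2)⁻¹ *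
      qKrawPoly q m₂ (q ^ z.1)⁻¹ (q ^ M)⁻¹ (φ ^ 2)⁻¹ * e
  · obtain ⟨l, rfl⟩ := Nat.exists_eq_add_of_le (Nat.add_le_add_iff_left.mp hn)
    split_ifs
    · exact (Hn_eq hq0 hq1 n₁ n₂ l θ hφ).symm
    · rw [mul_zero]
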